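/- Fix integers r ≥ 1 and s ≥ 1. The polynomial Σ_{j=0}^{rs} e_{j,s}(r)·x^j ∈ ℚ[x] is divisible by (1+x)^2 if and only if r is not squarefree. -/

import Mathlib

open Finset

/-- `f j (r) = (1/r) Σ_{d | gcd(r,j)} μ(d) (−1)^{j+j/d} C(r/d, j/d)` as a rational number. -/
def f (r j : ℕ) : ℚ :=
  (1 / (r : ℚ)) * ∑ d ∈ (Nat.gcd r j).divisors,
    ((ArithmeticFunction.moebius d : ℤ) : ℚ) * (-1) ^ (j + j / d) *
      ((r / d).choose (j / d) : ℚ)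

/-- `f_j(r)` as a natural number (the paper proves `f_j(r)` is a nonnegative integer). -/
def fNat (r j : ℕ) : ℕ := (f r j).num.toNat

/-- The set `P(i)_r^s` of partitions `γ = (γ_1 ≥ … ≥ γ_s ≥ 0)` with `Σ γ_l = i` and
`γ_1 ≤ r`, encoded as multisets of size `s` with entries in `{0,…,r}`. -/
def Pset (r s i : ℕ) : Finset (Sym (Fin (r + 1)) s) :=
  Finset.univ.filter fun γ => ((γ : Multiset (Fin (r + 1))).map Fin.val).sum = i

/-- The multiplicity `k_j(γ)` of the part `j` in `γ`. -/
def kmult {r s : ℕ} (γ : Sym (Fin (r + 1)) s) (j : ℕ) : ℕ :=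
  ((γ : Multiset (Fin (r + 1))).map Fin.val).count j

/-- `e_{i,s}(r) = Σ_{γ ∈ P(i)_r^s} Π_{j : k_j(γ)>0} C(f_j(r) + (k_j(γ)−1)δ_j, k_j(γ))`,
where `δ_j = 1` if `j` is even and `0` if `j` is odd. -/
def e (r s i : ℕ) : ℕ :=
  ∑ γ ∈ Pset r s i, ∏ j ∈ Finset.range (r + 1),
    if 0 < kmult γ j then
      (fNat r j + (kmult γ j - 1) * (if j % 2 = 0 then 1 else 0)).choose (kmult γ j)
    else 1

theorem sum_divisors_moebius {n : ℕ} :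
    ∑ d ∈ n.divisors, ArithmeticFunction.moebius d = if n = 1 then 1 else 0 := by
  rw [← ArithmeticFunction.coe_mul_zeta_apply, ArithmeticFunction.moebius_mul_coe_zeta,
    ArithmeticFunction.one_apply]

theorem divisors_gcd_eq_filter {r : ℕ} (hr : r ≠ 0) (j : ℕ) :
    (Nat.gcd r j).divisors = {d ∈ r.divisors | d ∣ j} := by
  ext d
  simp [Nat.dvd_gcd_iff, hr]

section Necklace

open scoped Pointwise

variable {G : Type*} [CommGroup G] [Fintype G]

theorem card_filter_mk_mem (K : Subgroup G) [DecidableEq (G ⧸ K)] (T : Finset (G ⧸ K)) :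
    #{x : G | (x : G ⧸ K) ∈ T} = Nat.card K * #T := by
  have h := Nat.card_congr (QuotientGroup.preimageMkEquivSubgroupProdSet K (T : Set (G ⧸ K)))
  rw [Nat.card_prod] at h
  have h2 : Nat.card (T : Set (G ⧸ K)) = #T := by simp
  rw [← h2, ← h]
  exact (Nat.subtype_card _ (by simp)).symm

theorem le_stabilizer_finset_iff [DecidableEq G] (K : Subgroup G) [DecidableEq (G ⧸ K)] (S : Finset G) :
    K ≤ MulAction.stabilizer G S ↔ 
      ∃ T : Finset (G ⧸ K), ({x : G | (x : G ⧸ K) ∈ T} : Finset G) = S := by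
  constructor
  · intro h
    refine ⟨S.image (QuotientGroup.mk : G → G ⧸ K), ?_⟩
    ext x
    simp only [mem_filter, mem_univ, true_and, mem_image]
    constructor
    · rintro ⟨y, hy, hyx⟩
      have hk := h (QuotientGroup.eq.mp hyx)
      rw [MulAction.mem_stabilizer_iff] at hk
      rw [← hk]
      have := Finset.smul_mem_smul_finset (a := y⁻¹ * x) hy
      simpa using this
    · exact fun hx => ⟨x, hx, rfl⟩
  · rintro ⟨T, rfl⟩ k hk
    rw [MulAction.mem_stabilizer_iff]
    ext x
    rw [← Finset.inv_smul_mem_iff]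
    simp only [mem_filter, mem_univ, true_and, smul_eq_mul]
    rw [show ((k⁻¹ * x : G) : G ⧸ K) = (x : G ⧸ K) from ?_]
    rw [QuotientGroup.eq]
    simpa using hk

open Classical in
theorem card_powersetCard_le_stabilizer (K : Subgroup G) (j : ℕ) :
    #{S ∈ powersetCard j (univ : Finset G) | K ≤ MulAction.stabilizer G S} =
      if Nat.card K ∣ j then K.index.choose (j / Nat.card K) else 0 := by
  have hpos : 0 < Nat.card K := Nat.card_pos
  have himg : {S ∈ powersetCard j (univ : Finset G) | K ≤ MulAction.stabilizer G S} =
      ({T : Finset (G ⧸ K) | Nat.card K * #T = j} : Finset _).image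
        (fun T => ({x : G | (x : G ⧸ K) ∈ T} : Finset G)) := by
    ext S
    simp only [mem_filter, mem_powersetCard, subset_univ, true_and, mem_image, mem_univ,
      le_stabilizer_finset_iff]
    constructor
    · rintro ⟨h, T, rfl⟩
      exact ⟨T, by rw [← card_filter_mk_mem, h], rfl⟩
    · rintro ⟨T, h, rfl⟩
      exact ⟨by rw [card_filter_mk_mem, h], T, rfl⟩
  rw [himg, card_image_of_injective]
  · split_ifs with hd
    · obtain ⟨c, rfl⟩ := hd
      rw [Nat.mul_div_cancel_left _ hpos, Subgroup.index, Nat.card_eq_fintype_card (α := G ⧸ K),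
        ← card_univ, ← card_powersetCard]
      congr 1
      ext T
      simp
    · rw [card_eq_zero, filter_eq_empty_iff]
      rintro T - rfl
      exact hd (dvd_mul_right _ _)
  · intro T T' h
    ext q
    obtain ⟨x, rfl⟩ := QuotientGroup.mk_surjective q
    simpa using Finset.ext_iff.mp h x

theorem eq_ker_powMonoidHom_card [IsCyclic G] (H : Subgroup G) :
    H = (powMonoidHom (Nat.card H) : G →* G).ker := by
  refine Subgroup.eq_of_le_of_card_ge (fun x hx => ?_) ?_
  · rw [MonoidHom.mem_ker, powMonoidHom_apply]
    exact congrArg Subtype.val (pow_card_eq_one' (x := (⟨x, hx⟩ : H)))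
  · rw [IsCyclic.card_powMonoidHom_ker]
    exact Nat.gcd_le_right _ Nat.card_pos

theorem card_ker_powMonoidHom_of_dvd [IsCyclic G] {d : ℕ} (hd : d ∣ Nat.card G) :
    Nat.card (powMonoidHom d : G →* G).ker = d := by
  rw [IsCyclic.card_powMonoidHom_ker, Nat.gcd_eq_right hd]

theorem dvd_card_iff_ker_powMonoidHom_le [IsCyclic G] {d : ℕ} (hd : d ∣ Nat.card G)
    (H : Subgroup G) : d ∣ Nat.card H ↔ (powMonoidHom d : G →* G).ker ≤ H := by
  constructor
  · rintro ⟨c, hc⟩ x hx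
    rw [eq_ker_powMonoidHom_card H]
    simp only [MonoidHom.mem_ker, powMonoidHom_apply] at hx ⊢
    rw [hc, pow_mul, hx, one_pow]
  · intro h
    simpa only [card_ker_powMonoidHom_of_dvd hd] using Subgroup.card_dvd_of_le h

open Classical in
theorem card_dvd_card_powersetCard_free (j : ℕ) :
    Nat.card G ∣ #{S ∈ powersetCard j (univ : Finset G) | MulAction.stabilizer G S = ⊥} := by
  let A : SubMulAction G (Finset G) :=
    { carrier := {S | #S = j ∧ MulAction.stabilizer G S = ⊥}
      smul_mem' := fun g S hS => by
        refine ⟨by simpa using hS.1, ?_⟩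
        rw [MulAction.stabilizer_smul_eq_stabilizer_map_conj, hS.2, Subgroup.map_bot] }
  have hfree : ∀ S : A, MulAction.stabilizer G S = ⊥ := fun S => by
    rw [SubMulAction.stabilizer_of_subMul]
    exact S.2.2
  have h := Nat.card_congr (MulAction.selfEquivOrbitsQuotientProd hfree)
  rw [Nat.card_prod] at h
  have hA : Nat.card A = #{S ∈ powersetCard j (univ : Finset G) | MulAction.stabilizer G S = ⊥} :=
    Nat.subtype_card _ fun S => by
      rw [mem_filter, mem_powersetCard_univ]; rfl
  rw [← hA, h]
  exact dvd_mul_left _ _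

open Classical in
variable (G) in
theorem exists_necklace_count_of_isCyclic [IsCyclic G] {r : ℕ} (hG : Nat.card G = r) (j : ℕ) :
    ∃ n : ℕ, ∑ d ∈ (Nat.gcd r j).divisors,
      ArithmeticFunction.moebius d * ((r / d).choose (j / d) : ℤ) = r * n := by
  have hr : r ≠ 0 := hG ▸ Nat.card_pos.ne'
  obtain ⟨n, hn⟩ := card_dvd_card_powersetCard_free (G := G) j
  refine ⟨n, ?_⟩
  rw [hG] at hn
  rw [← Nat.cast_mul, ← hn, divisors_gcd_eq_filter hr, card_filter, sum_filter]
  have key : ∀ S : Finset G, (((if MulAction.stabilizer G S = ⊥ then 1 else 0 : ℕ)) : ℤ) =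
      ∑ d ∈ r.divisors, if (powMonoidHom d : G →* G).ker ≤ MulAction.stabilizer G S then
        ArithmeticFunction.moebius d else 0 := by
    intro S
    have hdvd : Nat.card (MulAction.stabilizer G S) ∣ r := by
      conv_rhs => rw [← hG]
      exact Subgroup.card_subgroup_dvd_card _
    rw [← sum_filter]
    have : {d ∈ r.divisors | (powMonoidHom d : G →* G).ker ≤ MulAction.stabilizer G S} =
        (Nat.card (MulAction.stabilizer G S)).divisors := by
      ext d
      simp only [mem_filter, Nat.mem_divisors]
      constructor
      · rintro ⟨⟨h1, -⟩, h2⟩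
        exact ⟨(dvd_card_iff_ker_powMonoidHom_le (by rwa [hG]) _).mpr h2, Nat.card_pos.ne'⟩
      · rintro ⟨h1, -⟩
        have h2 := h1.trans hdvd
        exact ⟨⟨h2, hr⟩, (dvd_card_iff_ker_powMonoidHom_le (by rwa [hG]) _).mp h1⟩
    rw [this, sum_divisors_moebius]
    simp only [Subgroup.card_eq_one, Nat.cast_ite, Nat.cast_one, Nat.cast_zero]
  rw [Nat.cast_sum]
  trans ∑ S ∈ powersetCard j (univ : Finset G), ∑ d ∈ r.divisors,
    if (powMonoidHom d : G →* G).ker ≤ MulAction.stabilizer G S then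
      ArithmeticFunction.moebius d else 0
  swap
  · refine sum_congr rfl fun S _ => ?_
    rw [← key S]
  rw [sum_comm]
  refine sum_congr rfl fun d hd => ?_
  have hdr : d ∣ r := Nat.dvd_of_mem_divisors hd
  have hd0 : 0 < d := Nat.pos_of_mem_divisors hd
  rw [← sum_filter, sum_const, card_powersetCard_le_stabilizer,
    card_ker_powMonoidHom_of_dvd (by rwa [hG])]
  have hindex : (powMonoidHom d : G →* G).ker.index = r / d := by
    rw [IsCyclic.index_powMonoidHom_ker, hG, Nat.gcd_eq_right hdr]
  rw [hindex]
  split_ifs <;> simp [mul_comm]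

end Necklace

/-- The Möbius sum counting aperiodic binary necklaces with `r` beads, `j` of them black. -/
theorem exists_necklace_count {r : ℕ} (hr : r ≠ 0) (j : ℕ) :
    ∃ n : ℕ, ∑ d ∈ (Nat.gcd r j).divisors,
      ArithmeticFunction.moebius d * ((r / d).choose (j / d) : ℤ) = r * n := by
  have : NeZero r := ⟨hr⟩
  exact exists_necklace_count_of_isCyclic (Multiplicative (ZMod r)) (by simp) j

theorem moebius_two_mul_of_odd {d : ℕ} (hd : Odd d) :
    ArithmeticFunction.moebius (2 * d) = -ArithmeticFunction.moebius d := by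
  rw [ArithmeticFunction.isMultiplicative_moebius.map_mul_of_coprime
    (Nat.coprime_two_left.mpr hd), ArithmeticFunction.moebius_apply_prime Nat.prime_two, neg_one_mul]

theorem moebius_mul_neg_one_pow_of_not_two_mod_four {j d : ℕ} (hj : j % 4 ≠ 2) (hd : d ∣ j) :
    ArithmeticFunction.moebius d * (-1) ^ (j + j / d) = ArithmeticFunction.moebius d := by
  obtain ⟨c, rfl⟩ := hd
  rcases Nat.eq_zero_or_pos d with rfl | hpos
  · simp
  rw [Nat.mul_div_cancel_left _ hpos]
  rcases Nat.even_or_odd (d * c + c) with h | h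
  · rw [h.neg_one_pow, mul_one]
  · have hd4 : 4 ∣ d := by
      have hc : Odd c ∧ Even d := by
        simp only [Nat.odd_add, Nat.odd_mul, ← Nat.not_odd_iff_even] at h ⊢
        tauto
      obtain ⟨⟨a, rfl⟩, ⟨b, rfl⟩⟩ := hc
      rcases Nat.even_or_odd' b with ⟨e, rfl | rfl⟩
      · exact ⟨e, by ring⟩
      · refine absurd ?_ hj
        have : (2 * e + 1 + (2 * e + 1)) * (2 * a + 1) = 4 * (2 * e * a + e + a) + 2 := by ring
        omega
    have : ArithmeticFunction.moebius d = 0 := by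
      refine ArithmeticFunction.moebius_eq_zero_of_not_squarefree fun hsq => ?_
      have := hsq 2 hd4
      simp at this
    simp [this]

theorem filter_even_divisors_two_mul (n : ℕ) :
    {d ∈ (2 * n).divisors | Even d} = n.divisors.image (2 * ·) := by
  ext d
  simp only [mem_filter, Nat.mem_divisors, mem_image]
  constructor
  · rintro ⟨⟨h1, h2⟩, h3⟩
    obtain ⟨c, rfl⟩ := even_iff_two_dvd.mp h3
    exact ⟨c, ⟨Nat.dvd_of_mul_dvd_mul_left two_pos h1, by omega⟩, rfl⟩
  · rintro ⟨c, ⟨h1, h2⟩, rfl⟩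
    exact ⟨⟨Nat.mul_dvd_mul_left 2 h1, by omega⟩, even_two_mul c⟩

theorem exists_signed_necklace_count {r : ℕ} (hr : r ≠ 0) (j : ℕ) :
    ∃ n : ℕ, ∑ d ∈ (Nat.gcd r j).divisors,
      ArithmeticFunction.moebius d * (-1) ^ (j + j / d) * ((r / d).choose (j / d) : ℤ) = r * n := by
  obtain ⟨n, hn⟩ := exists_necklace_count hr j
  by_cases hj : j % 4 = 2
  · obtain ⟨k, rfl⟩ : ∃ k, j = 2 * k := ⟨j / 2, by omega⟩
    have hk : Odd k := Nat.odd_iff.mpr (by omega)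
    rcases Nat.even_or_odd' r with ⟨m, rfl | rfl⟩
    · have hm : m ≠ 0 := by omega
      obtain ⟨n', hn'⟩ := exists_necklace_count hm k
      refine ⟨n + n', ?_⟩
      have hodd : ∀ d ∈ (Nat.gcd m k).divisors, Odd d := fun d hd =>
        hk.of_dvd_nat ((Nat.dvd_of_mem_divisors hd).trans (Nat.gcd_dvd_right _ _))
      have hsplit : ∀ d ∈ (Nat.gcd (2 * m) (2 * k)).divisors,
          ArithmeticFunction.moebius d * (-1) ^ (2 * k + 2 * k / d) *
            ((2 * m / d).choose (2 * k / d) : ℤ) =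
          ArithmeticFunction.moebius d * ((2 * m / d).choose (2 * k / d) : ℤ) -
          2 * (if Even d then
            ArithmeticFunction.moebius d * ((2 * m / d).choose (2 * k / d) : ℤ) else 0) := by
        intro d hd
        obtain ⟨c, hc⟩ := (Nat.dvd_of_mem_divisors hd).trans (Nat.gcd_dvd_right _ _)
        have hd0 : 0 < d := Nat.pos_of_mem_divisors hd
        have hkc : 2 * k / d = c := by rw [hc, Nat.mul_div_cancel_left _ hd0]
        rw [hkc, pow_add, (even_two_mul k).neg_one_pow, one_mul]
        split_ifs with he
        · have : Odd c := by
            obtain ⟨b, rfl⟩ := even_iff_two_dvd.mp he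
            have : k = b * c := by
              rw [mul_assoc] at hc; exact Nat.eq_of_mul_eq_mul_left two_pos hc
            rw [this] at hk
            exact (Nat.odd_mul.mp hk).2
          rw [this.neg_one_pow]; ring
        · have : Even c := by
            have h := even_two_mul k
            rw [hc, Nat.even_mul] at h
            tauto
          rw [this.neg_one_pow]; ring
      rw [sum_congr rfl hsplit, sum_sub_distrib, hn, ← mul_sum, ← sum_filter, Nat.gcd_mul_left,
        filter_even_divisors_two_mul, sum_image (by intro a _ b _ h; simpa using h)]
      have : ∀ d ∈ (Nat.gcd m k).divisors, ArithmeticFunction.moebius (2 * d) *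
          ((2 * m / (2 * d)).choose (2 * k / (2 * d)) : ℤ) =
          -(ArithmeticFunction.moebius d * ((m / d).choose (k / d) : ℤ)) := by
        intro d hd
        rw [moebius_two_mul_of_odd (hodd d hd), Nat.mul_div_mul_left _ _ two_pos,
          Nat.mul_div_mul_left _ _ two_pos, neg_mul]
      rw [sum_congr rfl this, sum_neg_distrib, hn']
      push_cast
      ring
    · refine ⟨n, ?_⟩
      rw [← hn]
      refine sum_congr rfl fun d hd => ?_
      have hdvd := Nat.dvd_of_mem_divisors hd
      have hd1 : Odd d := Odd.of_dvd_nat (odd_two_mul_add_one m)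
        (hdvd.trans (Nat.gcd_dvd_left _ _))
      obtain ⟨c, hc⟩ := hdvd.trans (Nat.gcd_dvd_right _ _)
      have hkc : 2 * k / d = c := by rw [hc, Nat.mul_div_cancel_left _ hd1.pos]
      have hce : Even c := by
        have h := even_two_mul k
        rw [hc, Nat.even_mul, ← Nat.not_odd_iff_even] at h
        tauto
      rw [hkc, ((even_two_mul k).add hce).neg_one_pow, mul_one]
  · refine ⟨n, ?_⟩
    rw [← hn]
    refine sum_congr rfl fun d hd => ?_
    rw [moebius_mul_neg_one_pow_of_not_two_mod_four hj
      ((Nat.dvd_of_mem_divisors hd).trans (Nat.gcd_dvd_right _ _))]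

theorem f_eq_fNat {r : ℕ} (hr : r ≠ 0) (j : ℕ) : f r j = fNat r j := by
  obtain ⟨n, hn⟩ := exists_signed_necklace_count hr j
  have h : f r j = n := by
    have hn' := congrArg (Int.cast : ℤ → ℚ) hn
    push_cast at hn'
    have : (r : ℚ) ≠ 0 := by exact_mod_cast hr
    rw [f, hn']
    field_simp
  rw [fNat, h]
  simp

/-- Reindexing a sum over the multiples of `d` up to `r`. -/
theorem sum_range_ite_dvd {M : Type*} [AddCommMonoid M] {r d : ℕ} (hd : 0 < d) (hdr : d ∣ r)
    (g : ℕ → M) :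
    ∑ j ∈ range (r + 1), (if d ∣ j then g j else 0) = ∑ k ∈ range (r / d + 1), g (d * k) := by
  obtain ⟨m, rfl⟩ := hdr
  rw [Nat.mul_div_cancel_left _ hd, ← sum_filter,
    ← sum_image (s := range (m + 1)) (g := (d * ·)) (f := g)
      (by intro a _ b _ h; exact Nat.eq_of_mul_eq_mul_left hd h)]
  congr 1
  ext j
  simp only [mem_filter, mem_range, mem_image, Nat.lt_succ_iff]
  constructor
  · rintro ⟨h, c, rfl⟩
    exact ⟨c, Nat.le_of_mul_le_mul_left h hd, rfl⟩
  · rintro ⟨c, h, rfl⟩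
    exact ⟨Nat.mul_le_mul_left d h, dvd_mul_right _ _⟩

theorem alternating_sum_range_mul_choose {n : ℕ} (hn : n ≠ 0) :
    ∑ k ∈ range (n + 1), (-1 : ℤ) ^ k * k * n.choose k = if n = 1 then -1 else 0 := by
  obtain ⟨m, rfl⟩ := Nat.exists_eq_succ_of_ne_zero hn
  rw [sum_range_succ']
  have : ∀ k ∈ range (m + 1), (-1 : ℤ) ^ (k + 1) * ((k + 1 : ℕ) : ℤ) * (m + 1).choose (k + 1) =
      -(m + 1) * ((-1) ^ k * m.choose k) := by
    intro k _
    have := congrArg (Nat.cast : ℕ → ℤ) (Nat.add_one_mul_choose_eq m k)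
    push_cast at this ⊢
    rw [pow_succ]
    linear_combination (-1) ^ k * this
  rw [sum_congr rfl this, ← mul_sum, Int.alternating_sum_range_choose]
  by_cases hm : m = 0 <;> simp [hm]

/-- Exchanging the sum over `j` with the defining Möbius sum of `f r j`. -/
theorem sum_range_mul_f {r : ℕ} (hr : r ≠ 0) (w : ℕ → ℚ) :
    ∑ j ∈ range (r + 1), (-1) ^ j * w j * f r j =
      (1 / (r : ℚ)) * ∑ d ∈ r.divisors, ((ArithmeticFunction.moebius d : ℤ) : ℚ) *
        ∑ k ∈ range (r / d + 1), (-1) ^ k * w (d * k) * (r / d).choose k := by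
  simp only [f, divisors_gcd_eq_filter hr, sum_filter, mul_sum]
  rw [sum_comm]
  refine sum_congr rfl fun d hd => ?_
  have hd0 : 0 < d := Nat.pos_of_mem_divisors hd
  rw [sum_congr rfl fun j _ => ?_, sum_range_ite_dvd hd0 (Nat.dvd_of_mem_divisors hd)
    (fun j => (1 / (r : ℚ)) * (((ArithmeticFunction.moebius d : ℤ) : ℚ) *
      ((-1) ^ (j / d) * w j * (r / d).choose (j / d))))]
  · refine sum_congr rfl fun k _ => ?_
    rw [Nat.mul_div_cancel_left _ hd0]
  · split_ifs
    · have : ((-1 : ℚ) ^ j) ^ 2 = 1 := by rw [← pow_mul, mul_comm, pow_mul]; simp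
      rw [pow_add]
      linear_combination (1 / (r : ℚ)) * ((ArithmeticFunction.moebius d : ℤ) : ℚ) *
        (-1) ^ (j / d) * w j * (r / d).choose (j / d) * this
    · simp

theorem alternating_sum_f {r : ℕ} (hr : r ≠ 0) :
    ∑ j ∈ range (r + 1), (-1) ^ j * f r j = 0 := by
  have h := sum_range_mul_f hr fun _ => 1
  simp only [mul_one] at h
  rw [h, sum_eq_zero, mul_zero]
  intro d hd
  have hne : r / d ≠ 0 := (Nat.div_pos (Nat.divisor_le hd) (Nat.pos_of_mem_divisors hd)).ne'
  have := congrArg (Int.cast : ℤ → ℚ) (Int.alternating_sum_range_choose_of_ne hne)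
  push_cast at this
  rw [this, mul_zero]

theorem alternating_sum_mul_f {r : ℕ} (hr : r ≠ 0) :
    ∑ j ∈ range (r + 1), (-1) ^ j * j * f r j = -((ArithmeticFunction.moebius r : ℤ) : ℚ) := by
  rw [sum_range_mul_f hr fun j => j, sum_eq_single r]
  · have : (r : ℚ) ≠ 0 := by exact_mod_cast hr
    rw [Nat.div_self (Nat.pos_of_ne_zero hr)]
    simp [sum_range_succ]
    field_simp
  · intro d hd hne
    have hd0 := Nat.pos_of_mem_divisors hd
    have hq : r / d ≠ 0 := (Nat.div_pos (Nat.divisor_le hd) hd0).ne'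
    have hq1 : r / d ≠ 1 := fun h => hne (Nat.eq_of_dvd_of_div_eq_one (Nat.dvd_of_mem_divisors hd) h)
    have := congrArg (Int.cast : ℤ → ℚ) (alternating_sum_range_mul_choose hq)
    rw [if_neg hq1] at this
    push_cast at this
    rw [sum_congr rfl fun k _ => show (-1 : ℚ) ^ k * ((d * k : ℕ) : ℚ) * (r / d).choose k =
      d * ((-1) ^ k * k * (r / d).choose k) by push_cast; ring, ← mul_sum, this]
    simp
  · simp [hr]

theorem sum_sym_prod_count {ι R : Type*} [Fintype ι] [DecidableEq ι] [CommSemiring R] (s : ℕ)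
    (c : ι → ℕ → R) :
    ∑ γ : Sym ι s, ∏ i, c i ((γ : Multiset ι).count i) =
      PowerSeries.coeff s (∏ i, PowerSeries.mk (c i)) := by
  rw [PowerSeries.coeff_prod]
  simp only [PowerSeries.coeff_mk]
  refine sum_bij (fun γ _ => (Sym.equivNatSum ι s γ : ι →₀ ℕ)) ?_ ?_ ?_ ?_
  · intro γ _
    rw [mem_finsuppAntidiag]
    refine ⟨?_, subset_univ _⟩
    have := (Sym.equivNatSum ι s γ).2
    rwa [Finsupp.sum_fintype _ _ (fun _ => rfl)] at this
  · intro γ _ γ' _ h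
    exact (Sym.equivNatSum ι s).injective (Subtype.ext h)
  · intro l hl
    rw [mem_finsuppAntidiag] at hl
    refine ⟨(Sym.equivNatSum ι s).symm ⟨l, ?_⟩, mem_univ _, by simp⟩
    rw [Finsupp.sum_fintype _ _ (fun _ => rfl)]
    exact hl.1
  · intro γ _
    simp

/-- The weight of a part `j` of multiplicity `k` in the sum defining `e`. -/
def partWeight (r j k : ℕ) : ℕ :=
  if 0 < k then (fNat r j + (k - 1) * (if j % 2 = 0 then 1 else 0)).choose k else 1

theorem kmult_val {r s : ℕ} (γ : Sym (Fin (r + 1)) s) (i : Fin (r + 1)) :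
    kmult γ i = (γ : Multiset (Fin (r + 1))).count i :=
  Multiset.count_map_eq_count' _ _ Fin.val_injective _

theorem sum_map_val_eq {r s : ℕ} (γ : Sym (Fin (r + 1)) s) :
    ((γ : Multiset (Fin (r + 1))).map Fin.val).sum =
      ∑ i : Fin (r + 1), (γ : Multiset (Fin (r + 1))).count i * i := by
  rw [Finset.sum_multiset_map_count]
  simp only [smul_eq_mul]
  refine sum_subset (subset_univ _) fun i _ hi => ?_
  rw [Multiset.mem_toFinset] at hi
  simp [hi]

theorem sum_map_val_le {r s : ℕ} (γ : Sym (Fin (r + 1)) s) :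
    ((γ : Multiset (Fin (r + 1))).map Fin.val).sum ≤ r * s := by
  have := Multiset.sum_le_card_nsmul ((γ : Multiset (Fin (r + 1))).map Fin.val) r (by
    intro x hx
    obtain ⟨i, -, rfl⟩ := Multiset.mem_map.mp hx
    exact i.is_le)
  simpa [mul_comm] using this

theorem sum_e_mul_pow {R : Type*} [CommSemiring R] (r s : ℕ) (x : R) :
    ∑ j ∈ range (r * s + 1), (e r s j : R) * x ^ j =
      PowerSeries.coeff s (∏ j ∈ range (r + 1),
        PowerSeries.mk fun k => (partWeight r j k : R) * (x ^ j) ^ k) := by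
  rw [prod_range, ← sum_sym_prod_count s fun (i : Fin (r + 1)) k =>
    (partWeight r i k : R) * (x ^ (i : ℕ)) ^ k]
  have hmaps : ∀ γ ∈ (univ : Finset (Sym (Fin (r + 1)) s)),
      ((γ : Multiset (Fin (r + 1))).map Fin.val).sum ∈ range (r * s + 1) := fun γ _ =>
    mem_range.mpr (Nat.lt_succ_of_le (sum_map_val_le γ))
  rw [← sum_fiberwise_of_maps_to hmaps]
  refine sum_congr rfl fun j _ => ?_
  rw [e, Nat.cast_sum, sum_mul]
  refine sum_congr rfl fun γ hγ => ?_
  rw [← (mem_filter.mp hγ).2, sum_map_val_eq, prod_mul_distrib, ← prod_pow_eq_pow_sum, prod_range, Nat.cast_prod]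
  congr 1
  · refine prod_congr rfl fun i _ => ?_
    rw [kmult_val, partWeight]
  · refine prod_congr rfl fun i _ => ?_
    rw [← pow_mul, mul_comm]

open PowerSeries in
theorem mk_partWeight_of_odd {R : Type*} [CommRing R] (r : ℕ) {j : ℕ} (hj : Odd j) (y : R) :
    (PowerSeries.mk fun k => (partWeight r j k : R) * y ^ k) =
      (1 + C y * X) ^ fNat r j := by
  have h : (PowerSeries.mk fun k => (partWeight r j k : R) * y ^ k) =
      rescale y ((1 + X) ^ fNat r j : PowerSeries R) := by
    ext k
    have hc : (1 + X : PowerSeries R) ^ fNat r j =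
        ((1 + Polynomial.X : Polynomial R) ^ fNat r j : Polynomial R) := by simp
    rw [coeff_mk, coeff_rescale, hc, Polynomial.coeff_coe, Polynomial.coeff_one_add_X_pow,
      partWeight, if_neg (Nat.mod_two_ne_zero.mpr (Nat.odd_iff.mp hj)), mul_comm]
    rcases Nat.eq_zero_or_pos k with rfl | hk
    · simp
    · simp [hk]
  rw [h, map_pow, map_add, map_one, rescale_X]

open PowerSeries in
theorem mk_partWeight_mul_of_even {R : Type*} [CommRing R] (r : ℕ) {j : ℕ} (hj : Even j) (y : R) :
    (PowerSeries.mk fun k => (partWeight r j k : R) * y ^ k) * (1 - C y * X) ^ fNat r j = 1 := by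
  have h : (PowerSeries.mk fun k => (partWeight r j k : R) * y ^ k) =
      rescale y (invOneSubPow R (fNat r j) : PowerSeries R) := by
    ext k
    rw [coeff_mk, coeff_rescale, mul_comm, partWeight, if_pos (Nat.even_iff.mp hj), mul_one]
    congr 1
    rcases Nat.eq_zero_or_pos (fNat r j) with h0 | hpos
    · rw [h0, invOneSubPow_zero, Units.val_one, coeff_one]
      rcases Nat.eq_zero_or_pos k with rfl | hk
      · simp
      · rw [if_pos hk, if_neg hk.ne', Nat.choose_eq_zero_of_lt (by omega), Nat.cast_zero]
    · rw [invOneSubPow_val_eq_mk_sub_one_add_choose_of_pos _ _ hpos, coeff_mk]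
      rcases Nat.eq_zero_or_pos k with rfl | hk
      · simp
      · rw [if_pos hk, show fNat r j + (k - 1) = fNat r j - 1 + k by omega,
          Nat.choose_symm_add]
  have hX : (1 - C y * X : PowerSeries R) = rescale y (1 - X) := by
    rw [map_sub, map_one, rescale_X]
  rw [h, hX, ← map_pow, ← map_mul, ← invOneSubPow_inv_eq_one_sub_pow, Units.val_inv, map_one]

theorem prod_mul_pow_zpow {G : Type*} [CommGroup G] (t : Finset ℕ) (g : ℕ → ℤ) (a b : G) :
    ∏ j ∈ t, (a * b ^ j) ^ g j = a ^ (∑ j ∈ t, g j) * b ^ (∑ j ∈ t, (j : ℤ) * g j) := by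
  induction t using Finset.induction_on with
  | empty => simp
  | insert j t hj ih =>
    rw [prod_insert hj, sum_insert hj, sum_insert hj, zpow_add, zpow_add, ih, mul_zpow, zpow_mul,
      zpow_natCast, mul_mul_mul_comm]

section DualNumber

open PowerSeries DualNumber

/-- The unit `1 - t` of the ring of power series over the dual numbers. -/
noncomputable def oneSubUnit : (PowerSeries ℚ[ε])ˣ :=
  Units.mkOfMulEqOne (1 - X) (PowerSeries.mk 1) (by rw [mul_comm, mk_one_mul_one_sub_eq_one])

/-- The power series `ε t / (1 - t)`. -/
noncomputable def epsGeom : PowerSeries ℚ[ε] := C ε * X * PowerSeries.mk 1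

theorem epsGeom_mul_self : epsGeom * epsGeom = 0 := by
  have : (C ε * C ε : PowerSeries ℚ[ε]) = 0 := by rw [← map_mul, eps_mul_eps, map_zero]
  rw [epsGeom]
  linear_combination (X * PowerSeries.mk 1 * X * PowerSeries.mk 1) * this

/-- The unit `1 + ε t / (1 - t)` of the ring of power series over the dual numbers. -/
noncomputable def oneAddEpsGeomUnit : (PowerSeries ℚ[ε])ˣ :=
  Units.mkOfMulEqOne (1 + epsGeom) (1 - epsGeom) (by linear_combination -epsGeom_mul_self)

theorem val_oneAddEpsGeomUnit_pow (j : ℕ) :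
    ((oneAddEpsGeomUnit ^ j : (PowerSeries ℚ[ε])ˣ) : PowerSeries ℚ[ε]) = 1 + j * epsGeom := by
  induction j with
  | zero => simp
  | succ j ih =>
    rw [pow_succ, Units.val_mul, ih]
    change (1 + j * epsGeom) * (1 + epsGeom) = _
    push_cast
    linear_combination (j : PowerSeries ℚ[ε]) * epsGeom_mul_self

theorem neg_one_pow_mul_pow (j : ℕ) : (-1 : ℚ[ε]) ^ j * (-1 + ε) ^ j = 1 - (j : ℚ[ε]) * ε := by
  rw [← mul_pow]
  induction j with
  | zero => simp
  | succ j ih =>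
    rw [pow_succ, ih]
    push_cast
    linear_combination (j : ℚ[ε]) * eps_mul_eps (R := ℚ)

theorem one_sub_C_mul_X_eq (j : ℕ) :
    (1 - C ((-1 : ℚ[ε]) ^ j * (-1 + ε) ^ j) * X : PowerSeries ℚ[ε]) =
      ((oneSubUnit * oneAddEpsGeomUnit ^ j : (PowerSeries ℚ[ε])ˣ) : PowerSeries ℚ[ε]) := by
  rw [Units.val_mul, val_oneAddEpsGeomUnit_pow, neg_one_pow_mul_pow]
  change _ = (1 - X) * _
  rw [epsGeom, map_sub, map_mul, map_one, map_natCast]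
  linear_combination -(j : PowerSeries ℚ[ε]) * C ε * X * mk_one_mul_one_sub_eq_one ℚ[ε]

theorem mk_partWeight_eq (r j : ℕ) :
    (PowerSeries.mk fun k => (partWeight r j k : ℚ[ε]) * ((-1 + ε) ^ j) ^ k) =
      (((oneSubUnit * oneAddEpsGeomUnit ^ j) ^ (-((-1) ^ j * (fNat r j : ℤ))) :
        (PowerSeries ℚ[ε])ˣ) : PowerSeries ℚ[ε]) := by
  have h := one_sub_C_mul_X_eq j
  rcases Nat.even_or_odd j with hj | hj
  · rw [hj.neg_one_pow, one_mul] at h ⊢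
    rw [zpow_neg, zpow_natCast]
    refine Units.eq_inv_of_mul_eq_one_right ?_
    rw [Units.val_pow_eq_pow_val, ← h, mk_partWeight_mul_of_even r hj]
  · rw [hj.neg_one_pow, neg_one_mul] at h ⊢
    rw [neg_neg, zpow_natCast, Units.val_pow_eq_pow_val, ← h, mk_partWeight_of_odd r hj, map_neg,
      neg_mul, sub_neg_eq_add]

theorem val_oneAddEpsGeomUnit_zpow_moebius (r : ℕ) :
    ((oneAddEpsGeomUnit ^ ArithmeticFunction.moebius r : (PowerSeries ℚ[ε])ˣ) :
      PowerSeries ℚ[ε]) = 1 + ((ArithmeticFunction.moebius r : ℤ) : PowerSeries ℚ[ε]) * epsGeom := by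
  rcases ArithmeticFunction.moebius_eq_or r with h | h | h <;> rw [h]
  · simp
  · simp [oneAddEpsGeomUnit]
  · rw [zpow_neg_one]
    change 1 - epsGeom = _
    push_cast
    ring

theorem prod_mk_partWeight {r : ℕ} (hr : r ≠ 0) :
    ∏ j ∈ range (r + 1),
      (PowerSeries.mk fun k => (partWeight r j k : ℚ[ε]) * ((-1 + ε) ^ j) ^ k) =
      1 + ((ArithmeticFunction.moebius r : ℤ) : PowerSeries ℚ[ε]) * epsGeom := by
  have h0 : ∑ j ∈ range (r + 1), -((-1) ^ j * (fNat r j : ℤ)) = 0 := by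
    have := alternating_sum_f hr
    simp only [f_eq_fNat hr] at this
    rw [sum_neg_distrib, neg_eq_zero]
    exact_mod_cast this
  have h1 : ∑ j ∈ range (r + 1), (j : ℤ) * -((-1) ^ j * (fNat r j : ℤ)) =
      ArithmeticFunction.moebius r := by
    have := alternating_sum_mul_f hr
    simp only [f_eq_fNat hr] at this
    have h' : ∑ j ∈ range (r + 1), (-1) ^ j * (j : ℤ) * (fNat r j : ℤ) =
        -ArithmeticFunction.moebius r := by exact_mod_cast this
    rw [← neg_inj, ← h', ← sum_neg_distrib]
    exact sum_congr rfl fun j _ => by ring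
  simp only [mk_partWeight_eq]
  rw [← Units.coe_prod, prod_mul_pow_zpow, h0, h1, zpow_zero, one_mul,
    val_oneAddEpsGeomUnit_zpow_moebius]

theorem sum_e_mul_pow_dualNumber {r s : ℕ} (hr : r ≠ 0) (hs : s ≠ 0) :
    ∑ j ∈ range (r * s + 1), (e r s j : ℚ[ε]) * (-1 + ε) ^ j =
      ((ArithmeticFunction.moebius r : ℤ) : ℚ[ε]) * ε := by
  rw [sum_e_mul_pow, prod_mk_partWeight hr]
  obtain ⟨m, rfl⟩ := Nat.exists_eq_succ_of_ne_zero hs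
  rw [map_add, coeff_one, if_neg hs, zero_add, ← map_intCast (C (R := ℚ[ε])), coeff_C_mul, epsGeom,
    mul_assoc, coeff_C_mul, coeff_succ_X_mul, coeff_mk]
  simp

end DualNumber

open Polynomial DualNumber in
theorem one_add_X_sq_dvd_iff (P : ℚ[X]) :
    (1 + X) ^ 2 ∣ P ↔ aeval (-1 + ε : ℚ[ε]) P = 0 := by
  have hε : aeval (-1 + ε : ℚ[ε]) ((1 + X) ^ 2 : ℚ[X]) = 0 := by
    simp [pow_two]
  constructor
  · rintro ⟨Q, rfl⟩
    rw [map_mul, hε, zero_mul]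
  · intro h
    have hmonic : ((1 + X) ^ 2 : ℚ[X]).Monic := by
      rw [add_comm, ← C_1]; exact (monic_X_add_C 1).pow 2
    have hdeg : ((1 + X) ^ 2 : ℚ[X]).natDegree = 2 := by
      rw [add_comm, ← C_1, natDegree_pow, natDegree_X_add_C]
    rw [← modByMonic_eq_zero_iff_dvd hmonic]
    have hlt : (P %ₘ (1 + X) ^ 2).natDegree ≤ 1 := by
      have := natDegree_modByMonic_lt P hmonic (by intro h1; rw [h1] at hdeg; simp at hdeg)
      omega
    obtain ⟨a, b, hab⟩ := exists_eq_X_add_C_of_natDegree_le_one hlt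
    rw [← modByMonic_add_div P ((1 + X) ^ 2), map_add, map_mul, hε, zero_mul, add_zero, hab] at h
    have h1 := congrArg TrivSqZeroExt.fst h
    have h2 := congrArg TrivSqZeroExt.snd h
    simp [TrivSqZeroExt.algebraMap_eq_inl] at h1 h2
    rw [hab, h2, show b = 0 by linarith]
    simp

open Polynomial in
/-- For `r, s ≥ 1`, the polynomial `Σ_{j=0}^{rs} e_{j,s}(r) x^j` is divisible by
`(1+x)^2` in `ℚ[x]` if and only if `r` is not squarefree. -/
theorem stmt11 (r s : ℕ) (hr : 1 ≤ r) (hs : 1 ≤ s) :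
    ((1 + X) ^ 2 ∣ ∑ j ∈ Finset.range (r * s + 1), C ((e r s j : ℚ)) * X ^ j) ↔
      ¬ Squarefree r := by
  rw [one_add_X_sq_dvd_iff, ← ArithmeticFunction.moebius_ne_zero_iff_squarefree, not_not]
  have h := sum_e_mul_pow_dualNumber (r := r) (s := s) (by omega) (by omega)
  have h' : aeval (-1 + DualNumber.eps : DualNumber ℚ)
      (∑ j ∈ Finset.range (r * s + 1), C ((e r s j : ℚ)) * X ^ j) =
      ((ArithmeticFunction.moebius r : ℤ) : DualNumber ℚ) * DualNumber.eps := by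
    rw [← h]
    simp
  rw [h']
  constructor
  · intro h0
    simpa using congrArg TrivSqZeroExt.snd h0
  · intro h0
    simp [h0]
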